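/- Let s₁ < 1 and s₁ + s₂ > 0. There exists a constant C = C(s₁, s₂) > 0 such that for all f, g ∈ Ḣ^{s₁}(ℝ²) ∩ Ḣ^{s₂}(ℝ²), one has ‖fg‖_{Ḣ^{s₁+s₂−1}} ≤ C ( ‖f‖_{Ḣ^{s₁}} ‖g‖_{Ḣ^{s₂}} + ‖f‖_{Ḣ^{s₂}} ‖g‖_{Ḣ^{s₁}} ). -/

import Mathlib

open MeasureTheory FourierTransform Real

noncomputable section

abbrev E2 := EuclideanSpace ℝ (Fin 2)

/-- The homogeneous Sobolev norm `‖u‖_{Ḣˢ(ℝ²)}`, defined via the Fourier transform. -/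
def hdotNorm (s : ℝ) (u : E2 → ℂ) : ℝ :=
  (∫ ξ, ‖ξ‖ ^ (2 * s) * ‖𝓕 u ξ‖ ^ 2) ^ (1 / 2 : ℝ)

open scoped ENNReal NNReal

lemma cs_sq {α : Type*} [MeasurableSpace α] {μ : Measure α} {f g : α → ℝ≥0∞}
    (hf : AEMeasurable f μ) (hg : AEMeasurable g μ) :
    (∫⁻ x, f x * g x ∂μ) ^ 2 ≤ (∫⁻ x, f x ^ 2 ∂μ) * ∫⁻ x, g x ^ 2 ∂μ := by
  have h := ENNReal.lintegral_mul_le_Lp_mul_Lq μ (p := 2) (q := 2)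
    (Real.holderConjugate_iff.mpr ⟨by norm_num, by norm_num⟩) hf hg
  have h2 := pow_le_pow_left' h 2
  simp only [Pi.mul_apply, ENNReal.rpow_ofNat] at h2
  refine h2.trans (le_of_eq ?_)
  rw [mul_pow, ← ENNReal.rpow_natCast, ← ENNReal.rpow_natCast, ← ENNReal.rpow_mul,
    ← ENNReal.rpow_mul]
  norm_num

lemma rpow_comp {x y t : ℝ} (hx : 0 < x) (hy : 0 < y) (h1 : x / 2 ≤ y) (h2 : y ≤ 2 * x) :
    y ^ t ≤ 2 ^ |t| * x ^ t := by
  rcases le_total 0 t with ht | ht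
  · rw [abs_of_nonneg ht, ← Real.mul_rpow (by norm_num) hx.le]
    exact Real.rpow_le_rpow hy.le h2 ht
  · rw [abs_of_nonpos ht]
    calc y ^ t ≤ (x / 2) ^ t := Real.rpow_le_rpow_of_nonpos (by positivity) h1 ht
      _ = _ := by
        rw [Real.div_rpow hx.le (by norm_num), Real.rpow_neg (by norm_num)]; field_simp

lemma kernel_bound (s₁ s₂ : ℝ) {a b r : ℝ} (ha : 0 < a) (hb : 0 < b) (hr : 0 < r)
    (hab : a ≤ b) (h1 : r ≤ a + b) (h2 : b ≤ a + r) :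
    a ^ (-s₁) * b ^ (-s₂) ≤ (2 ^ |(-s₁)| + 2 ^ |(-s₂)|) *
      ((if a < 4 * r then a ^ (-s₁) * r ^ (-s₂) else 0) +
       (if r < b then b ^ (-(s₁ + s₂)) else 0)) := by
  have e1 : (0:ℝ) ≤ if a < 4 * r then a ^ (-s₁) * r ^ (-s₂) else 0 := by
    split_ifs <;> positivity
  have e2 : (0:ℝ) ≤ if r < b then b ^ (-(s₁ + s₂)) else 0 := by
    split_ifs <;> positivity
  have p1 : (0:ℝ) < 2 ^ |(-s₁)| := by positivity
  have p2 : (0:ℝ) < 2 ^ |(-s₂)| := by positivity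
  rcases lt_or_ge r (b / 2) with hc | hc
  · have := rpow_comp (t := -s₁) hb ha (by linarith) (by linarith)
    rw [if_pos (show r < b by linarith)] at e2 ⊢
    calc a ^ (-s₁) * b ^ (-s₂) ≤ (2 ^ |(-s₁)| * b ^ (-s₁)) * b ^ (-s₂) := by gcongr
      _ = 2 ^ |(-s₁)| * b ^ (-(s₁ + s₂)) := by
        rw [mul_assoc, ← Real.rpow_add hb]; ring_nf
      _ ≤ _ := by gcongr <;> linarith
  · have := rpow_comp (t := -s₂) hr hb (by linarith) (by linarith)
    rw [if_pos (show a < 4 * r by linarith)] at e1 ⊢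
    calc a ^ (-s₁) * b ^ (-s₂) ≤ a ^ (-s₁) * (2 ^ |(-s₂)| * r ^ (-s₂)) := by gcongr
      _ = 2 ^ |(-s₂)| * (a ^ (-s₁) * r ^ (-s₂)) := by ring
      _ ≤ _ := by gcongr <;> linarith

lemma radial_bound {p : ℝ} (hp : -2 < p) : ∃ C : ℝ≥0, ∀ R : ℝ, 0 < R →
    ∫⁻ x : E2, (if ‖x‖ < R then ENNReal.ofReal (‖x‖ ^ p) else 0)
      ≤ C * ENNReal.ofReal (R ^ (p + 2)) := by
  have hfin : Module.finrank ℝ E2 = 2 := by simp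
  have hint : IntegrableOn (fun x : E2 => ‖x‖ ^ p) (Metric.ball 0 1) := by
    refine integrableOn_ball_of_norm_le_rpow (C := 1) (α := -p) (by simp) (by
      rw [hfin]; push_cast; linarith) ?_ ?_
    · refine Filter.Eventually.of_forall fun x => ?_
      rw [Real.norm_of_nonneg (by positivity)]; simp
    · exact (by fun_prop : Measurable fun x : E2 => ‖x‖ ^ p).aestronglyMeasurable
  have hfi : ∫⁻ x : E2, (if ‖x‖ < 1 then ENNReal.ofReal (‖x‖ ^ p) else 0) ≠ ⊤ := by
    have h1 := hint.lintegral_lt_top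
    rw [← lintegral_indicator measurableSet_ball] at h1
    refine ne_of_lt (lt_of_eq_of_lt (lintegral_congr fun x => ?_) h1)
    simp [Set.indicator]
  refine ⟨(∫⁻ x : E2, (if ‖x‖ < 1 then ENNReal.ofReal (‖x‖ ^ p) else 0)).toNNReal, fun R hR => ?_⟩
  rw [ENNReal.coe_toNNReal hfi]
  have hm : Measurable fun x : E2 => (if ‖x‖ < R then ENNReal.ofReal (‖x‖ ^ p) else 0) :=
    Measurable.ite (measurableSet_lt (by fun_prop) (by fun_prop)) (by fun_prop) (by fun_prop)
  have hmap := Measure.map_addHaar_smul (volume : Measure E2) hR.ne'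
  have h3 : ∫⁻ x : E2, (if ‖R • x‖ < R then ENNReal.ofReal (‖R • x‖ ^ p) else 0)
      = ENNReal.ofReal ((R ^ 2)⁻¹) *
        ∫⁻ x : E2, (if ‖x‖ < R then ENNReal.ofReal (‖x‖ ^ p) else 0) := by
    rw [← lintegral_map hm (by fun_prop), hmap, lintegral_smul_measure, hfin,
      abs_of_pos (by positivity), smul_eq_mul]
  have h4 : ∫⁻ x : E2, (if ‖R • x‖ < R then ENNReal.ofReal (‖R • x‖ ^ p) else 0)
      = ENNReal.ofReal (R ^ p) *
        ∫⁻ x : E2, (if ‖x‖ < 1 then ENNReal.ofReal (‖x‖ ^ p) else 0) := by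
    rw [← lintegral_const_mul']
    · refine lintegral_congr fun x => ?_
      rw [norm_smul, Real.norm_of_nonneg hR.le, Real.mul_rpow hR.le (norm_nonneg _),
        ENNReal.ofReal_mul (by positivity)]
      have : R * ‖x‖ < R ↔ ‖x‖ < 1 := by
        constructor <;> intro h <;> nlinarith
      simp [this]
    · exact ENNReal.ofReal_ne_top
  apply le_of_eq
  calc _ = ENNReal.ofReal (R ^ 2) * (ENNReal.ofReal ((R ^ 2)⁻¹) *
        ∫⁻ x : E2, (if ‖x‖ < R then ENNReal.ofReal (‖x‖ ^ p) else 0)) := by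
        rw [← mul_assoc, ← ENNReal.ofReal_mul (by positivity), mul_inv_cancel₀ (by positivity)]
        simp
    _ = _ := by
      rw [← h3, h4, Real.rpow_add hR, Real.rpow_two, ENNReal.ofReal_mul (by positivity)]
      ring

lemma fourier_mul_le (f g : SchwartzMap E2 ℂ) (ξ : E2) :
    ‖𝓕 (fun x => f x * g x) ξ‖ₑ ≤ ∫⁻ η, ‖𝓕 (⇑f) (ξ - η)‖ₑ * ‖𝓕 (⇑g) η‖ₑ := by
  have h1 := SchwartzMap.convolution_apply (ContinuousLinearMap.mul ℂ ℂ) (𝓕 g) (𝓕 f) ξ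
  have h2 : SchwartzMap.convolution (ContinuousLinearMap.mul ℂ ℂ) (𝓕 g) (𝓕 f) ξ
      = 𝓕 (fun x => f x * g x) ξ := by
    have key : ∀ (f : SchwartzMap E2 ℂ) x, (𝓕 (𝓕 f)) (-x) = f x := by
      intro f x
      have : 𝓕⁻ (𝓕 f) = f := by simp
      conv_rhs => rw [← this]
      rw [SchwartzMap.fourierInv_coe, Real.fourierInv_eq_fourier_neg, SchwartzMap.fourier_coe]
    simp only [SchwartzMap.convolution]
    simp only [LinearMap.coe_mk, AddHom.coe_mk, ContinuousLinearMap.comp_apply,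
      FourierTransform.fourierInvCLM_apply, FourierTransform.fourierCLM_apply]
    rw [SchwartzMap.fourierInv_coe, Real.fourierInv_eq_fourier_comp_neg]
    refine congrArg (fun h : E2 → ℂ => (𝓕 h : E2 → ℂ) ξ) (funext fun x => ?_)
    simp [key, mul_comm]
  rw [← h2, h1, convolution]
  refine (enorm_integral_le_lintegral_enorm _).trans (le_of_eq (lintegral_congr fun η => ?_))
  simp [SchwartzMap.fourier_coe, mul_comm, enorm_mul]

lemma ae_ne0 (c : E2) : ∀ᵐ x : E2, x ≠ c := by
  simp [ae_iff]

lemma conv_sq {u v : E2 → ℝ≥0∞} (hu : Measurable u) (hv : Measurable v) :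
    ∫⁻ ξ, ∫⁻ η, (u (ξ - η) * v η) ^ 2 = (∫⁻ x, u x ^ 2) * ∫⁻ x, v x ^ 2 := by
  rw [lintegral_lintegral_swap (by fun_prop)]
  have : ∀ η, ∫⁻ ξ, (u (ξ - η) * v η) ^ 2 = (∫⁻ x, u x ^ 2) * v η ^ 2 := by
    intro η
    simp_rw [mul_pow]
    rw [lintegral_mul_const _ (by fun_prop), lintegral_sub_right_eq_self (fun x => u x ^ 2)]
  simp_rw [this]
  rw [lintegral_const_mul _ (by fun_prop)]

lemma low1 (s₁ s₂ : ℝ) (h₁ : s₁ < 1) : ∃ C : ℝ≥0, ∀ u v : E2 → ℝ≥0∞,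
    Measurable u → Measurable v →
    ∫⁻ ξ : E2, ENNReal.ofReal (‖ξ‖ ^ (2 * (s₁ + s₂ - 1))) *
      (∫⁻ η, ENNReal.ofReal (if ‖ξ - η‖ < 4 * ‖ξ‖ then ‖ξ - η‖ ^ (-s₁) * ‖ξ‖ ^ (-s₂) else 0) *
        (u (ξ - η) * v η)) ^ 2 ≤ C * ((∫⁻ x, u x ^ 2) * ∫⁻ x, v x ^ 2) := by
  obtain ⟨C, hC⟩ := radial_bound (p := -s₁ * 2) (by linarith)
  refine ⟨C * (4 ^ (-s₁ * 2 + 2) : ℝ).toNNReal, fun u v hu hv => ?_⟩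
  rw [← conv_sq hu hv, ← lintegral_const_mul _ (by fun_prop)]
  refine lintegral_mono_ae ?_
  filter_upwards [ae_ne0 0] with ξ hξ
  have hr : 0 < ‖ξ‖ := norm_pos_iff.mpr hξ
  have hW : Measurable fun η : E2 => ENNReal.ofReal
      (if ‖ξ - η‖ < 4 * ‖ξ‖ then ‖ξ - η‖ ^ (-s₁) * ‖ξ‖ ^ (-s₂) else 0) :=
    (Measurable.ite (measurableSet_lt (by fun_prop) (by fun_prop)) (by fun_prop)
      (by fun_prop)).ennreal_ofReal
  have hcs := cs_sq (μ := (volume : Measure E2)) hW.aemeasurable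
    (by fun_prop : Measurable fun η => u (ξ - η) * v η).aemeasurable
  have hI : ∫⁻ η : E2, ENNReal.ofReal
      (if ‖ξ - η‖ < 4 * ‖ξ‖ then ‖ξ - η‖ ^ (-s₁) * ‖ξ‖ ^ (-s₂) else 0) ^ 2
      ≤ ENNReal.ofReal (‖ξ‖ ^ (-s₂ * 2)) *
        (C * ENNReal.ofReal ((4 * ‖ξ‖) ^ (-s₁ * 2 + 2))) := by
    refine le_trans (le_of_eq ?_) (mul_le_mul_right (hC (4 * ‖ξ‖) (by positivity)) _)
    rw [← lintegral_sub_left_eq_self _ ξ, ← lintegral_const_mul' _ _ ENNReal.ofReal_ne_top]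
    refine lintegral_congr fun η => ?_
    simp only [sub_sub_cancel]
    split_ifs
    · rw [← ENNReal.ofReal_pow (by positivity), ← ENNReal.ofReal_mul (by positivity)]
      congr 1
      rw [mul_pow, ← Real.rpow_two, ← Real.rpow_two, ← Real.rpow_mul (norm_nonneg _),
        ← Real.rpow_mul (norm_nonneg _), mul_comm]
    · simp
  calc _ ≤ ENNReal.ofReal (‖ξ‖ ^ (2 * (s₁ + s₂ - 1))) * ((ENNReal.ofReal (‖ξ‖ ^ (-s₂ * 2)) *
        (C * ENNReal.ofReal ((4 * ‖ξ‖) ^ (-s₁ * 2 + 2)))) * ∫⁻ η, (u (ξ - η) * v η) ^ 2) := by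
        gcongr
        exact hcs.trans (mul_le_mul_left hI _)
    _ = (C * (ENNReal.ofReal (‖ξ‖ ^ (2 * (s₁ + s₂ - 1))) * ENNReal.ofReal (‖ξ‖ ^ (-s₂ * 2)) *
        ENNReal.ofReal ((4 * ‖ξ‖) ^ (-s₁ * 2 + 2)))) * ∫⁻ η, (u (ξ - η) * v η) ^ 2 := by ring
    _ = _ := by
      rw [← ENNReal.ofReal_mul (by positivity), ← ENNReal.ofReal_mul (by positivity),
        Real.mul_rpow (by norm_num) hr.le, mul_left_comm, ← Real.rpow_add hr, ← Real.rpow_add hr]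
      have : 2 * (s₁ + s₂ - 1) + -s₂ * 2 + (-s₁ * 2 + 2) = 0 := by ring
      rw [this, Real.rpow_zero, mul_one]
      simp [ENNReal.ofReal]

lemma low2 (s : ℝ) (hs : 0 < s) : ∃ C : ℝ≥0, ∀ u v : E2 → ℝ≥0∞,
    Measurable u → Measurable v →
    ∫⁻ ξ : E2, ENNReal.ofReal (‖ξ‖ ^ (2 * (s - 1))) *
      (∫⁻ η : E2, ENNReal.ofReal (if ‖ξ‖ < ‖η‖ then ‖η‖ ^ (-s) else 0) *
        (u (ξ - η) * v η)) ^ 2 ≤ C * ((∫⁻ x, u x ^ 2) * ∫⁻ x, v x ^ 2) := by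
  obtain ⟨C, hC⟩ := radial_bound (p := 2 * (s - 1)) (by linarith)
  refine ⟨C, fun u v hu hv => ?_⟩
  have hW : Measurable fun p : E2 × E2 => ENNReal.ofReal
      (if ‖p.1‖ < ‖p.2‖ then ‖p.2‖ ^ (-s) else 0) :=
    (Measurable.ite (measurableSet_lt (by fun_prop) (by fun_prop)) (by fun_prop)
      (by fun_prop)).ennreal_ofReal
  have hW1 : ∀ ξ : E2, Measurable fun η : E2 => ENNReal.ofReal
      (if ‖ξ‖ < ‖η‖ then ‖η‖ ^ (-s) else 0) := fun ξ =>
    (Measurable.ite (measurableSet_lt (by fun_prop) (by fun_prop)) (by fun_prop)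
      (by fun_prop)).ennreal_ofReal
  have hm : Measurable fun p : E2 × E2 => ENNReal.ofReal (‖p.1‖ ^ (2 * (s - 1))) *
      (ENNReal.ofReal (if ‖p.1‖ < ‖p.2‖ then ‖p.2‖ ^ (-s) else 0) * v p.2) ^ 2 :=
    Measurable.mul (by fun_prop) ((hW.mul (hv.comp measurable_snd)).pow_const 2)
  calc _ ≤ ∫⁻ ξ : E2, (∫⁻ x, u x ^ 2) * ∫⁻ η : E2, ENNReal.ofReal (‖ξ‖ ^ (2 * (s - 1))) *
          (ENNReal.ofReal (if ‖ξ‖ < ‖η‖ then ‖η‖ ^ (-s) else 0) * v η) ^ 2 := by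
        refine lintegral_mono fun ξ => ?_
        have hcs := cs_sq (μ := (volume : Measure E2)) (f := fun η => u (ξ - η))
          (g := fun η => ENNReal.ofReal (if ‖ξ‖ < ‖η‖ then ‖η‖ ^ (-s) else 0) * v η)
          (by fun_prop) ((hW1 ξ).mul hv).aemeasurable
        rw [lintegral_sub_left_eq_self (fun x => u x ^ 2)] at hcs
        rw [lintegral_const_mul' _ _ ENNReal.ofReal_ne_top, mul_left_comm]
        refine mul_le_mul_right (le_trans (le_of_eq ?_) hcs) _
        congr 1
        exact lintegral_congr fun η => by ring
    _ = (∫⁻ x, u x ^ 2) * ∫⁻ η : E2, ∫⁻ ξ : E2, ENNReal.ofReal (‖ξ‖ ^ (2 * (s - 1))) *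
          (ENNReal.ofReal (if ‖ξ‖ < ‖η‖ then ‖η‖ ^ (-s) else 0) * v η) ^ 2 := by
        rw [lintegral_const_mul _ hm.lintegral_prod_right', lintegral_lintegral_swap hm.aemeasurable]
    _ ≤ (∫⁻ x, u x ^ 2) * ∫⁻ η : E2, C * v η ^ 2 := by
        refine mul_le_mul_right (lintegral_mono_ae ?_) _
        filter_upwards [ae_ne0 0] with η hη
        have hb : 0 < ‖η‖ := norm_pos_iff.mpr hη
        calc _ = ∫⁻ ξ : E2, (if ‖ξ‖ < ‖η‖ then ENNReal.ofReal (‖ξ‖ ^ (2 * (s - 1))) else 0) *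
              (ENNReal.ofReal (‖η‖ ^ (-s * 2)) * v η ^ 2) := by
              refine lintegral_congr fun ξ => ?_
              split_ifs
              · rw [mul_pow, ← ENNReal.ofReal_pow (by positivity), Real.rpow_mul hb.le,
                  Real.rpow_two]
              · simp
          _ = (∫⁻ ξ : E2, (if ‖ξ‖ < ‖η‖ then ENNReal.ofReal (‖ξ‖ ^ (2 * (s - 1))) else 0)) *
              (ENNReal.ofReal (‖η‖ ^ (-s * 2)) * v η ^ 2) := by
              refine lintegral_mul_const _ ?_
              exact Measurable.ite (measurableSet_lt (by fun_prop) (by fun_prop)) (by fun_prop)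
                (by fun_prop)
          _ ≤ (C * ENNReal.ofReal (‖η‖ ^ (2 * (s - 1) + 2))) *
              (ENNReal.ofReal (‖η‖ ^ (-s * 2)) * v η ^ 2) := mul_le_mul_left (hC _ hb) _
          _ = C * (ENNReal.ofReal (‖η‖ ^ (2 * (s - 1) + 2)) * ENNReal.ofReal (‖η‖ ^ (-s * 2))) *
              v η ^ 2 := by ring
          _ = _ := by
              rw [← ENNReal.ofReal_mul (by positivity), ← Real.rpow_add hb]
              have : 2 * (s - 1) + 2 + -s * 2 = 0 := by ring
              rw [this]; simp
    _ = _ := by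
        rw [lintegral_const_mul _ (by fun_prop)]; ring

/-- squared weighted norm as a lower integral -/
def wN (s : ℝ) (F : E2 → ℝ≥0∞) : ℝ≥0∞ := ∫⁻ x, ENNReal.ofReal (‖x‖ ^ (2 * s)) * F x ^ 2

lemma enn_add_sq_le (a b : ℝ≥0∞) : (a + b) ^ 2 ≤ 2 * (a ^ 2 + b ^ 2) := by
  induction a with
  | top => simp
  | coe a =>
    induction b with
    | top => simp
    | coe b => exact_mod_cast add_sq_le (a := a) (b := b)

lemma low (s₁ s₂ : ℝ) (h₁ : s₁ < 1) (h : 0 < s₁ + s₂) : ∃ C : ℝ≥0, ∀ F G : E2 → ℝ≥0∞,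
    Measurable F → Measurable G →
    ∫⁻ ξ : E2, ENNReal.ofReal (‖ξ‖ ^ (2 * (s₁ + s₂ - 1))) *
      (∫⁻ η, if ‖ξ - η‖ ≤ ‖η‖ then F (ξ - η) * G η else 0) ^ 2
      ≤ C * (wN s₁ F * wN s₂ G) := by
  obtain ⟨C1, hC1⟩ := low1 s₁ s₂ h₁
  obtain ⟨C2, hC2⟩ := low2 (s₁ + s₂) h
  set K : ℝ := 2 ^ |(-s₁)| + 2 ^ |(-s₂)| with hK
  have hK0 : 0 ≤ K := by positivity
  refine ⟨K.toNNReal ^ 2 * 2 * (C1 + C2), fun F G hF hG => ?_⟩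
  set u : E2 → ℝ≥0∞ := fun x => ENNReal.ofReal (‖x‖ ^ s₁) * F x with hu
  set v : E2 → ℝ≥0∞ := fun x => ENNReal.ofReal (‖x‖ ^ s₂) * G x with hv
  have hum : Measurable u := by fun_prop
  have hvm : Measurable v := by fun_prop
  have hsq : ∀ (s : ℝ) (F : E2 → ℝ≥0∞),
      wN s F = ∫⁻ x, (ENNReal.ofReal (‖x‖ ^ s) * F x) ^ 2 := by
    intro s F
    refine lintegral_congr fun x => ?_
    rw [mul_pow, ← ENNReal.ofReal_pow (by positivity), ← Real.rpow_two,
      ← Real.rpow_mul (norm_nonneg _), mul_comm s 2]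
  have B1 := hC1 u v hum hvm
  have B2 := hC2 u v hum hvm
  rw [← hsq, ← hsq] at B1 B2
  set W1 : E2 → E2 → ℝ≥0∞ := fun ξ η =>
    ENNReal.ofReal (if ‖ξ - η‖ < 4 * ‖ξ‖ then ‖ξ - η‖ ^ (-s₁) * ‖ξ‖ ^ (-s₂) else 0) with hW1
  set W2 : E2 → E2 → ℝ≥0∞ := fun ξ η =>
    ENNReal.ofReal (if ‖ξ‖ < ‖η‖ then ‖η‖ ^ (-(s₁ + s₂)) else 0) with hW2
  have mW1 : Measurable fun p : E2 × E2 => W1 p.1 p.2 :=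
    (Measurable.ite (measurableSet_lt (by fun_prop) (by fun_prop)) (by fun_prop)
      (by fun_prop)).ennreal_ofReal
  have mW2 : Measurable fun p : E2 × E2 => W2 p.1 p.2 :=
    (Measurable.ite (measurableSet_lt (by fun_prop) (by fun_prop)) (by fun_prop)
      (by fun_prop)).ennreal_ofReal
  have m1 : Measurable fun p : E2 × E2 => W1 p.1 p.2 * (u (p.1 - p.2) * v p.2) :=
    mW1.mul (by fun_prop)
  have m1' : Measurable fun ξ : E2 => ENNReal.ofReal (‖ξ‖ ^ (2 * (s₁ + s₂ - 1))) *
      (∫⁻ η, W1 ξ η * (u (ξ - η) * v η)) ^ 2 :=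
    Measurable.mul (by fun_prop) (m1.lintegral_prod_right'.pow_const 2)
  have key : ∀ᵐ ξ : E2, (∫⁻ η, if ‖ξ - η‖ ≤ ‖η‖ then F (ξ - η) * G η else 0) ≤
      ENNReal.ofReal K * ((∫⁻ η, W1 ξ η * (u (ξ - η) * v η)) +
        ∫⁻ η, W2 ξ η * (u (ξ - η) * v η)) := by
    filter_upwards [ae_ne0 0] with ξ hξ
    have mW1ξ : Measurable fun η => W1 ξ η :=
      (Measurable.ite (measurableSet_lt (by fun_prop) (by fun_prop)) (by fun_prop)
        (by fun_prop)).ennreal_ofReal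
    have m1ξ : Measurable fun η => W1 ξ η * (u (ξ - η) * v η) := mW1ξ.mul (by fun_prop)
    rw [← lintegral_add_left m1ξ, ← lintegral_const_mul' _ _ ENNReal.ofReal_ne_top]
    refine lintegral_mono_ae ?_
    filter_upwards [ae_ne0 0, ae_ne0 ξ] with η hη hηξ
    split_ifs with hle
    swap
    · simp
    have hr : 0 < ‖ξ‖ := norm_pos_iff.mpr hξ
    have hb : 0 < ‖η‖ := norm_pos_iff.mpr hη
    have ha : 0 < ‖ξ - η‖ := norm_pos_iff.mpr (sub_ne_zero.mpr hηξ.symm)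
    have t1 : ‖ξ‖ ≤ ‖ξ - η‖ + ‖η‖ := by simpa using norm_add_le (ξ - η) η
    have t2 : ‖η‖ ≤ ‖ξ - η‖ + ‖ξ‖ := by
      have := norm_add_le (η - ξ) ξ
      rw [norm_sub_rev] at this
      simpa using this
    have kb := ENNReal.ofReal_le_ofReal (kernel_bound s₁ s₂ ha hb hr hle t1 t2)
    have kb' : ENNReal.ofReal (‖ξ - η‖ ^ (-s₁) * ‖η‖ ^ (-s₂)) ≤
        ENNReal.ofReal K * (W1 ξ η + W2 ξ η) := by
      refine kb.trans (le_of_eq ?_)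
      rw [ENNReal.ofReal_mul hK0]
      congr 1
      exact ENNReal.ofReal_add (by split_ifs <;> positivity) (by split_ifs <;> positivity)
    calc F (ξ - η) * G η = ENNReal.ofReal (‖ξ - η‖ ^ (-s₁) * ‖η‖ ^ (-s₂)) *
          (u (ξ - η) * v η) := by
          have c1 : ENNReal.ofReal (‖ξ - η‖ ^ (-s₁)) * ENNReal.ofReal (‖ξ - η‖ ^ s₁) = 1 := by
            rw [← ENNReal.ofReal_mul (by positivity), ← Real.rpow_add ha]; simp
          have c2 : ENNReal.ofReal (‖η‖ ^ (-s₂)) * ENNReal.ofReal (‖η‖ ^ s₂) = 1 := by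
            rw [← ENNReal.ofReal_mul (by positivity), ← Real.rpow_add hb]; simp
          rw [ENNReal.ofReal_mul (by positivity)]
          calc F (ξ - η) * G η = 1 * 1 * (F (ξ - η) * G η) := by ring
            _ = (ENNReal.ofReal (‖ξ - η‖ ^ (-s₁)) * ENNReal.ofReal (‖ξ - η‖ ^ s₁)) *
                (ENNReal.ofReal (‖η‖ ^ (-s₂)) * ENNReal.ofReal (‖η‖ ^ s₂)) *
                (F (ξ - η) * G η) := by rw [c1, c2]
            _ = _ := by simp only [hu, hv]; ring
      _ ≤ (ENNReal.ofReal K * (W1 ξ η + W2 ξ η)) * (u (ξ - η) * v η) := mul_le_mul_left kb' _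
      _ = _ := by ring
  have hKe : ((K.toNNReal : ℝ≥0) : ℝ≥0∞) = ENNReal.ofReal K := rfl
  calc _ ≤ ∫⁻ ξ : E2, (ENNReal.ofReal K ^ 2 * 2) *
        (ENNReal.ofReal (‖ξ‖ ^ (2 * (s₁ + s₂ - 1))) * (∫⁻ η, W1 ξ η * (u (ξ - η) * v η)) ^ 2 +
        ENNReal.ofReal (‖ξ‖ ^ (2 * (s₁ + s₂ - 1))) * (∫⁻ η, W2 ξ η * (u (ξ - η) * v η)) ^ 2) := by
        refine lintegral_mono_ae ?_
        filter_upwards [key] with ξ hξ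
        refine (mul_le_mul_right ((pow_le_pow_left' hξ 2).trans
          (le_of_eq_of_le (mul_pow _ _ _) (mul_le_mul_right (enn_add_sq_le _ _) _))) _).trans ?_
        apply le_of_eq; ring
    _ ≤ (ENNReal.ofReal K ^ 2 * 2) * (C1 * (wN s₁ F * wN s₂ G) + C2 * (wN s₁ F * wN s₂ G)) := by
        rw [lintegral_const_mul' _ _ (by finiteness), lintegral_add_left m1']
        gcongr
    _ = _ := by push_cast; rw [hKe]; ring

lemma full (s₁ s₂ : ℝ) (h₁ : s₁ < 1) (h : 0 < s₁ + s₂) : ∃ C : ℝ≥0, ∀ F G : E2 → ℝ≥0∞,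
    Measurable F → Measurable G →
    ∫⁻ ξ : E2, ENNReal.ofReal (‖ξ‖ ^ (2 * (s₁ + s₂ - 1))) *
      (∫⁻ η, F (ξ - η) * G η) ^ 2
      ≤ C * (wN s₁ F * wN s₂ G + wN s₂ F * wN s₁ G) := by
  obtain ⟨C, hC⟩ := low s₁ s₂ h₁ h
  refine ⟨2 * C, fun F G hF hG => ?_⟩
  have hm : ∀ F G : E2 → ℝ≥0∞, Measurable F → Measurable G →
      Measurable fun p : E2 × E2 => if ‖p.1 - p.2‖ ≤ ‖p.2‖ then F (p.1 - p.2) * G p.2 else 0 :=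
    fun F G hF hG => Measurable.ite (measurableSet_le (by fun_prop) (by fun_prop)) (by fun_prop)
      (by fun_prop)
  have mm : Measurable fun ξ : E2 => ENNReal.ofReal (‖ξ‖ ^ (2 * (s₁ + s₂ - 1))) *
      (∫⁻ η, if ‖ξ - η‖ ≤ ‖η‖ then F (ξ - η) * G η else 0) ^ 2 :=
    Measurable.mul (by fun_prop) ((hm F G hF hG).lintegral_prod_right'.pow_const 2)
  have key : ∀ ξ : E2, (∫⁻ η, F (ξ - η) * G η) ≤
      (∫⁻ η, if ‖ξ - η‖ ≤ ‖η‖ then F (ξ - η) * G η else 0) +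
      (∫⁻ η, if ‖ξ - η‖ ≤ ‖η‖ then G (ξ - η) * F η else 0) := by
    intro ξ
    have e := lintegral_sub_left_eq_self (μ := (volume : Measure E2))
      (fun η => if ‖ξ - η‖ ≤ ‖η‖ then G (ξ - η) * F η else 0) ξ
    have mξ : Measurable fun η => if ‖ξ - η‖ ≤ ‖η‖ then F (ξ - η) * G η else 0 :=
      Measurable.ite (measurableSet_le (by fun_prop) (by fun_prop)) (by fun_prop) (by fun_prop)
    rw [← e, ← lintegral_add_left mξ]
    refine lintegral_mono fun η => ?_
    simp only [sub_sub_cancel]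
    rcases le_total ‖ξ - η‖ ‖η‖ with h | h
    · rw [if_pos h]; exact le_self_add
    · rw [if_pos h, mul_comm]; exact le_add_self
  calc _ ≤ ∫⁻ ξ : E2, 2 * (ENNReal.ofReal (‖ξ‖ ^ (2 * (s₁ + s₂ - 1))) *
          (∫⁻ η, if ‖ξ - η‖ ≤ ‖η‖ then F (ξ - η) * G η else 0) ^ 2 +
        ENNReal.ofReal (‖ξ‖ ^ (2 * (s₁ + s₂ - 1))) *
          (∫⁻ η, if ‖ξ - η‖ ≤ ‖η‖ then G (ξ - η) * F η else 0) ^ 2) := by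
        refine lintegral_mono fun ξ => ?_
        refine (mul_le_mul_right ((pow_le_pow_left' (key ξ) 2).trans (enn_add_sq_le _ _)) _).trans ?_
        apply le_of_eq; ring
    _ ≤ 2 * (C * (wN s₁ F * wN s₂ G) + C * (wN s₁ G * wN s₂ F)) := by
        rw [lintegral_const_mul' _ _ (by finiteness), lintegral_add_left mm]
        gcongr
        · exact hC F G hF hG
        · exact hC G F hG hF
    _ = _ := by push_cast; ring

/-- Symmetric product law in homogeneous Sobolev spaces: for `s₁ < 1`, `s₁ + s₂ > 0`,
`‖fg‖_{Ḣ^{s₁+s₂−1}} ≤ C (‖f‖_{Ḣ^{s₁}} ‖g‖_{Ḣ^{s₂}} + ‖f‖_{Ḣ^{s₂}} ‖g‖_{Ḣ^{s₁}})`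
for `f, g ∈ Ḣ^{s₁}(ℝ²) ∩ Ḣ^{s₂}(ℝ²)`. -/
theorem stmt4 (s₁ s₂ : ℝ) (h₁ : s₁ < 1) (h : 0 < s₁ + s₂) :
    ∃ C > (0 : ℝ), ∀ f g : SchwartzMap E2 ℂ,
      Integrable (fun ξ => ‖ξ‖ ^ (2 * s₁) * ‖𝓕 (⇑f) ξ‖ ^ 2) →
      Integrable (fun ξ => ‖ξ‖ ^ (2 * s₂) * ‖𝓕 (⇑f) ξ‖ ^ 2) →
      Integrable (fun ξ => ‖ξ‖ ^ (2 * s₁) * ‖𝓕 (⇑g) ξ‖ ^ 2) →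
      Integrable (fun ξ => ‖ξ‖ ^ (2 * s₂) * ‖𝓕 (⇑g) ξ‖ ^ 2) →
      hdotNorm (s₁ + s₂ - 1) (fun x => f x * g x)
        ≤ C * (hdotNorm s₁ (⇑f) * hdotNorm s₂ (⇑g) +
               hdotNorm s₂ (⇑f) * hdotNorm s₁ (⇑g)) := by
  obtain ⟨C, hC⟩ := full s₁ s₂ h₁ h
  refine ⟨√C + 1, by positivity, fun f g f1 f2 g1 g2 => ?_⟩
  have nn : ∀ (s : ℝ) (u : E2 → ℂ), 0 ≤ ∫ ξ, ‖ξ‖ ^ (2 * s) * ‖𝓕 u ξ‖ ^ 2 :=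
    fun s u => integral_nonneg fun ξ => by positivity
  have pt : ∀ (s : ℝ) (u : E2 → ℂ) (ξ : E2), ENNReal.ofReal (‖ξ‖ ^ (2 * s) * ‖𝓕 u ξ‖ ^ 2) =
      ENNReal.ofReal (‖ξ‖ ^ (2 * s)) * ‖𝓕 u ξ‖ₑ ^ 2 := by
    intro s u ξ
    rw [ENNReal.ofReal_mul (by positivity), ENNReal.ofReal_pow (norm_nonneg (𝓕 u ξ)),
      ofReal_norm (𝓕 u ξ)]
  have eqN : ∀ (s : ℝ) (u : E2 → ℂ), Integrable (fun ξ => ‖ξ‖ ^ (2 * s) * ‖𝓕 u ξ‖ ^ 2) →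
      ENNReal.ofReal (∫ ξ, ‖ξ‖ ^ (2 * s) * ‖𝓕 u ξ‖ ^ 2) = wN s (fun ξ => ‖𝓕 u ξ‖ₑ) := by
    intro s u hu
    rw [ofReal_integral_eq_lintegral_ofReal hu (Filter.Eventually.of_forall fun ξ => by
      positivity)]
    exact lintegral_congr fun ξ => pt s u ξ
  have meas : ∀ f : SchwartzMap E2 ℂ, Measurable fun ξ => ‖𝓕 (⇑f) ξ‖ₑ := by
    intro f
    rw [← SchwartzMap.fourier_coe]
    exact (𝓕 f).continuous.enorm.measurable
  have main : (∫ ξ, ‖ξ‖ ^ (2 * (s₁ + s₂ - 1)) * ‖𝓕 (fun x => f x * g x) ξ‖ ^ 2) ≤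
      C * ((∫ ξ, ‖ξ‖ ^ (2 * s₁) * ‖𝓕 (⇑f) ξ‖ ^ 2) * (∫ ξ, ‖ξ‖ ^ (2 * s₂) * ‖𝓕 (⇑g) ξ‖ ^ 2) +
        (∫ ξ, ‖ξ‖ ^ (2 * s₂) * ‖𝓕 (⇑f) ξ‖ ^ 2) * (∫ ξ, ‖ξ‖ ^ (2 * s₁) * ‖𝓕 (⇑g) ξ‖ ^ 2)) := by
    have a1 := nn s₁ f
    have a2 := nn s₂ f
    have b1 := nn s₁ g
    have b2 := nn s₂ g
    by_cases hi : Integrable (fun ξ : E2 =>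
        ‖ξ‖ ^ (2 * (s₁ + s₂ - 1)) * ‖𝓕 (fun x => f x * g x) ξ‖ ^ 2)
    swap
    · rw [integral_undef hi]; positivity
    rw [← ENNReal.ofReal_le_ofReal_iff (by positivity), eqN _ _ hi,
      ENNReal.ofReal_mul (by positivity), ENNReal.ofReal_add (by positivity) (by positivity),
      ENNReal.ofReal_mul a1, ENNReal.ofReal_mul a2, eqN _ _ f1, eqN _ _ f2, eqN _ _ g1,
      eqN _ _ g2, ENNReal.ofReal_coe_nnreal]
    refine le_trans (lintegral_mono fun ξ => ?_) (hC _ _ (meas f) (meas g))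
    gcongr
    exact fourier_mul_le f g ξ
  simp only [hdotNorm, ← Real.sqrt_eq_rpow]
  rw [← Real.sqrt_mul (nn _ _), ← Real.sqrt_mul (nn _ _)]
  have sub : ∀ x y : ℝ, 0 ≤ x → 0 ≤ y → √(x + y) ≤ √x + √y := by
    intro x y hx hy
    rw [Real.sqrt_le_left (by positivity)]
    nlinarith [Real.sq_sqrt hx, Real.sq_sqrt hy, mul_nonneg (Real.sqrt_nonneg x) (Real.sqrt_nonneg y)]
  refine (Real.sqrt_le_sqrt main).trans ?_
  rw [Real.sqrt_mul C.coe_nonneg]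
  gcongr
  · linarith
  · exact sub _ _ (mul_nonneg (nn _ _) (nn _ _)) (mul_nonneg (nn _ _) (nn _ _))

end
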